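/- arXiv:math/9811053 — 6 statements merged into one kernel-verified Lean document; each statement's English description precedes it below -/
import Mathlib

section
/- Let E be a finite-dimensional real normed vector space, let C ⊆ E be a convex set, and let (f_n)_{n ∈ ℕ} be a sequence of nonzero linear functionals on E. If C is contained in the union over n of the kernels ker(f_n), then there exists some n such that C ⊆ ker(f_n). -/
open Polynomial in
/-- Countably many nonzero real polynomials have a common positive non-root. -/
theorem exists_pos_forall_eval_ne_zero {ι : Type*} [Countable ι] (p : ι → ℝ[X])
    (hp : ∀ i, p i ≠ 0) : ∃ t : ℝ, 0 < t ∧ ∀ i, (p i).eval t ≠ 0 := by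
  by_contra! hroot
  have hcount : (Set.Ioi (0 : ℝ)).Countable := by
    refine (Set.countable_iUnion fun i => (p i).roots.toFinset.countable_toSet).mono
      fun t ht => ?_
    obtain ⟨i, hi⟩ := hroot t ht
    simpa using ⟨i, hp i, hi⟩
  rw [← Cardinal.le_aleph0_iff_set_countable, Cardinal.mk_Ioi_real] at hcount
  exact Cardinal.aleph0_lt_continuum.not_ge hcount

open Polynomial in
/-- Given finitely many points of a convex set that is covered by countably many kernels, one of
the kernels contains all these points. The proof intersects the kernels with a rescaled moment
curve through the simplex spanned by the points. -/
theorem Convex.exists_forall_mem_ker_of_subset_iUnion {E ι : Type*} [AddCommGroup E] [Module ℝ E]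
    [Countable ι] {C : Set E} (hC : Convex ℝ C) (f : ι → E →ₗ[ℝ] ℝ)
    (h : C ⊆ ⋃ n, (LinearMap.ker (f n) : Set E)) {d : ℕ} (hd : 0 < d) (v : Fin d → E)
    (hv : ∀ i, v i ∈ C) : ∃ n, ∀ i, v i ∈ LinearMap.ker (f n) := by
  by_contra! hne
  let p : ι → ℝ[X] := fun n => ∑ i : Fin d, Polynomial.C (f n (v i)) * X ^ (i : ℕ)
  have hp : ∀ n, p n ≠ 0 := by
    intro n hn
    obtain ⟨i, hi⟩ := hne n
    apply hi
    have hcoeff := congrArg (fun q : ℝ[X] => q.coeff (i : ℕ)) hn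
    simpa [p, finsetSum_coeff, coeff_X_pow, Fin.val_inj] using hcoeff
  obtain ⟨t, ht, hroot⟩ := exists_pos_forall_eval_ne_zero p hp
  have hpos : 0 < ∑ i : Fin d, t ^ (i : ℕ) :=
    Finset.sum_pos (fun i _ => pow_pos ht _) ⟨⟨0, hd⟩, Finset.mem_univ _⟩
  have hmem := hC.centerMass_mem (t := Finset.univ) (w := fun i : Fin d => t ^ (i : ℕ)) (z := v)
    (fun i _ => (pow_pos ht _).le) hpos fun i _ => hv i
  obtain ⟨n, hn⟩ := Set.mem_iUnion.1 (h hmem)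
  apply hroot n
  have hsum : ∑ i : Fin d, t ^ (i : ℕ) * f n (v i) = 0 := by
    rw [SetLike.mem_coe, LinearMap.mem_ker, Finset.centerMass, map_smul, map_sum] at hn
    simpa only [map_smul, smul_eq_mul] using (smul_eq_zero.1 hn).resolve_left (inv_ne_zero hpos.ne')
  simp only [p, eval_finsetSum, eval_mul, eval_C, eval_pow, eval_X]
  rw [← hsum]
  exact Finset.sum_congr rfl fun i _ => mul_comm _ _

/-- A convex subset of a finite-dimensional real normed space contained in a
countable union of kernels of nonzero linear functionals is contained in one of them. -/
theorem convex_subset_iUnion_hyperplanes {E : Type*} [NormedAddCommGroup E] [NormedSpace ℝ E]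
    [FiniteDimensional ℝ E] (C : Set E) (hC : Convex ℝ C) (f : ℕ → E →ₗ[ℝ] ℝ)
    (hf : ∀ n, f n ≠ 0) (h : C ⊆ ⋃ n, (LinearMap.ker (f n) : Set E)) :
    ∃ n, C ⊆ (LinearMap.ker (f n) : Set E) := by
  obtain ⟨v, hv, hspan, -⟩ := Submodule.exists_fun_fin_finrank_span_eq ℝ C
  rcases (Module.finrank ℝ (Submodule.span ℝ C)).eq_zero_or_pos with hd | hd
  · refine ⟨0, Submodule.span_le.1 ?_⟩
    rw [Submodule.finrank_eq_zero.1 hd]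
    exact bot_le
  · obtain ⟨n, hn⟩ := hC.exists_forall_mem_ker_of_subset_iUnion f h hd v hv
    refine ⟨n, Submodule.span_le.1 ?_⟩
    rw [← hspan, Submodule.span_le]
    exact Set.range_subset_iff.2 hn
end

section
/- Let k be a field and V a finite-dimensional k-vector space. Call a function F : V → k a polynomial function if it belongs to the k-subalgebra of all functions V → k generated by the linear functionals V → k. Let V₊ and V₋ be linear subspaces of V, and let F₊, F₋ : V → k be polynomial functions such that F₊(v) = F₋(v) for all v ∈ V₊ ∩ V₋. Then there exists a polynomial function F : V → k such that F(v) = F₊(v) for all v ∈ V₊ and F(v) = F₋(v) for all v ∈ V₋. -/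
/-- A polynomial function on a vector space `V` over `k`: an element of the `k`-subalgebra
of the algebra of all functions `V → k` generated by the linear functionals. -/
def IsPolynomialFun (k : Type*) {V : Type*} [Field k] [AddCommGroup V] [Module k V]
    (F : V → k) : Prop :=
  F ∈ Algebra.adjoin k {f : V → k | ∃ φ : V →ₗ[k] k, f = ⇑φ}

theorem IsPolynomialFun.comp_linearMap {k V W : Type*} [Field k] [AddCommGroup V] [Module k V]
    [AddCommGroup W] [Module k W] {F : W → k} (hF : IsPolynomialFun k F) (Q : V →ₗ[k] W) :
    IsPolynomialFun k (F ∘ Q) := by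
  unfold IsPolynomialFun at hF ⊢
  induction hF using Algebra.adjoin_induction with
  | mem f hf =>
    obtain ⟨φ, rfl⟩ := hf
    exact Algebra.subset_adjoin ⟨φ ∘ₗ Q, rfl⟩
  | algebraMap r => exact Subalgebra.algebraMap_mem _ r
  | add f g _ _ hf hg => exact add_mem hf hg
  | mul f g _ _ hf hg => exact mul_mem hf hg

theorem Submodule.exists_linearMap_retract_mapsTo_inf {k V : Type*} [Field k] [AddCommGroup V]
    [Module k V] (p q : Submodule k V) :
    ∃ Q : V →ₗ[k] V, (∀ v ∈ q, Q v = v) ∧ ∀ v ∈ p, Q v ∈ p ⊓ q := by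
  obtain ⟨c, hc⟩ := Submodule.exists_isCompl (p ⊓ q)
  have hdisj : Disjoint (p ⊓ c) q := by
    rw [Submodule.disjoint_def]
    intro x hx hxq
    exact (Submodule.disjoint_def.1 hc.disjoint) x ⟨hx.1, hxq⟩ hx.2
  obtain ⟨d, hcd, hd⟩ := hdisj.exists_isCompl
  refine ⟨q.subtype ∘ₗ q.projectionOnto d hd.symm, fun v hv => ?_, fun v hv => ?_⟩
  · exact congrArg Subtype.val (Submodule.projectionOnto_apply_left hd.symm ⟨v, hv⟩)
  · obtain ⟨u, hu, w, hw, rfl⟩ := Submodule.mem_sup.1 (hc.sup_eq_top ▸ Submodule.mem_top (x := v))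
    have hwp : w ∈ p := (Submodule.add_mem_iff_right p hu.1).1 hv
    have hw0 : q.projectionOnto d hd.symm w = 0 :=
      (Submodule.projectionOnto_apply_eq_zero_iff hd.symm).2 (hcd ⟨hwp, hw⟩)
    have hu1 : q.projectionOnto d hd.symm u = ⟨u, hu.2⟩ :=
      Submodule.projectionOnto_apply_left hd.symm ⟨u, hu.2⟩
    simpa [hw0, hu1] using hu

/-- Two polynomial functions agreeing on the intersection of two subspaces
`V₊`, `V₋` of a finite-dimensional vector space can be glued to a single polynomial
function on `V` restricting to each of them on `V₊`, resp. `V₋`. -/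
theorem polynomialFun_glue {k V : Type*} [Field k] [AddCommGroup V] [Module k V]
    [FiniteDimensional k V] (Vp Vm : Submodule k V) (Fp Fm : V → k)
    (hFp : IsPolynomialFun k Fp) (hFm : IsPolynomialFun k Fm)
    (hagree : ∀ v ∈ Vp ⊓ Vm, Fp v = Fm v) :
    ∃ F : V → k, IsPolynomialFun k F ∧ (∀ v ∈ Vp, F v = Fp v) ∧ ∀ v ∈ Vm, F v = Fm v := by
  obtain ⟨Q, hQ, hQp⟩ := Submodule.exists_linearMap_retract_mapsTo_inf Vp Vm
  refine ⟨Fp + (Fm - Fp) ∘ Q, ?_, fun v hv => ?_, fun v hv => ?_⟩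
  · have hsub : IsPolynomialFun k (Fm - Fp) := sub_mem hFm hFp
    exact add_mem hFp (hsub.comp_linearMap Q)
  · simp [hagree _ (hQp v hv)]
  · simp [hQ v hv]
end

section
/- Let A be a commutative integral domain equipped with a ℤ-grading A = ⊕_{n ∈ ℤ} A_n, let K be a field, and let ε : A → K be a ring homomorphism whose restriction to the degree-zero component A₀ is injective. Suppose there exist an integer n₀ > 0 and a nonzero homogeneous element f₀ ∈ A_{n₀} with ε(f₀) = 0. Then A_n = 0 for every n < 0, i.e., A is concentrated in nonnegative degrees. -/
/-- Let `A` be a commutative integral domain with a `ℤ`-grading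
`A = ⊕_{n ∈ ℤ} 𝒜 n`, `K` a field, and `ε : A →+* K` a ring homomorphism injective on the
degree-zero component `𝒜 0`. If there are an integer `n₀ > 0` and a nonzero homogeneous
`f₀ ∈ 𝒜 n₀` with `ε f₀ = 0`, then `𝒜 n = 0` for every `n < 0`. -/
theorem graded_domain_nonneg_degrees {A : Type*} [CommRing A] [IsDomain A]
    (𝒜 : ℤ → AddSubgroup A) [GradedRing 𝒜] {K : Type*} [Field K] (ε : A →+* K)
    (hε : Set.InjOn ε (𝒜 0)) (n₀ : ℤ) (hn₀ : 0 < n₀) (f₀ : A) (hf₀ : f₀ ∈ 𝒜 n₀)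
    (hf₀ne : f₀ ≠ 0) (hεf₀ : ε f₀ = 0) :
    ∀ n : ℤ, n < 0 → ∀ x ∈ 𝒜 n, x = 0 := by
  intro n hn x hx
  have hmem : x ^ n₀.toNat * f₀ ^ (-n).toNat ∈ 𝒜 0 := by
    have h := SetLike.mul_mem_graded (SetLike.pow_mem_graded n₀.toNat hx)
      (SetLike.pow_mem_graded (-n).toNat hf₀)
    have hdeg : n₀.toNat • n + (-n).toNat • n₀ = 0 := by
      rw [nsmul_eq_mul, nsmul_eq_mul, Int.toNat_of_nonneg hn₀.le,
        Int.toNat_of_nonneg (by lia)]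
      ring
    rwa [hdeg] at h
  have hzero : x ^ n₀.toNat * f₀ ^ (-n).toNat = 0 := by
    refine hε hmem (zero_mem (𝒜 0)) ?_
    rw [map_mul, map_pow ε f₀, hεf₀, zero_pow (by lia), mul_zero, map_zero]
  exact eq_zero_of_pow_eq_zero
    ((mul_eq_zero.mp hzero).resolve_right (pow_ne_zero _ hf₀ne))
end

section
/- The additive submonoid of ℕ⁴ consisting of all quadruples (a, b, c, d) of natural numbers satisfying 3a + b = c + 3d is generated by the four elements (1,0,0,1), (0,1,1,0), (1,0,3,0), (0,3,0,1). -/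
/-- The additive submonoid of `ℕ⁴` of quadruples `(a, b, c, d)` with
`3a + b = c + 3d` is generated by `(1,0,0,1)`, `(0,1,1,0)`, `(1,0,3,0)`, `(0,3,0,1)`. -/
theorem submonoid_weight_zero_generated :
    (AddSubmonoid.closure
        ({(1, 0, 0, 1), (0, 1, 1, 0), (1, 0, 3, 0), (0, 3, 0, 1)} :
          Set (ℕ × ℕ × ℕ × ℕ)) : Set (ℕ × ℕ × ℕ × ℕ)) =
      {p : ℕ × ℕ × ℕ × ℕ | 3 * p.1 + p.2.1 = p.2.2.1 + 3 * p.2.2.2} := by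
  ext p
  simp only [SetLike.mem_coe, Set.mem_ofPred_eq]
  constructor
  · intro hp
    induction hp using AddSubmonoid.closure_induction with
    | mem x hx => rcases hx with rfl | rfl | rfl | rfl <;> rfl
    | zero => rfl
    | add x y _ _ hx hy =>
      simp only [Prod.fst_add, Prod.snd_add]
      omega
  · obtain ⟨a, b, c, d⟩ := p
    intro h
    dsimp only at h
    set S : Set (ℕ × ℕ × ℕ × ℕ) := {(1, 0, 0, 1), (0, 1, 1, 0), (1, 0, 3, 0), (0, 3, 0, 1)}
      with hS
    have mem {x : ℕ × ℕ × ℕ × ℕ} (hx : x ∈ S) (n : ℕ) : n • x ∈ AddSubmonoid.closure S :=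
      nsmul_mem (AddSubmonoid.subset_closure hx) n
    rcases le_total a d with had | hda
    · obtain ⟨k, rfl⟩ := Nat.exists_eq_add_of_le had
      obtain rfl : b = c + 3 * k := by omega
      have key := add_mem (add_mem (mem (x := (1, 0, 0, 1)) (by simp [hS]) a)
        (mem (x := (0, 1, 1, 0)) (by simp [hS]) c)) (mem (x := (0, 3, 0, 1)) (by simp [hS]) k)
      simpa [mul_comm] using key
    · obtain ⟨k, rfl⟩ := Nat.exists_eq_add_of_le hda
      obtain rfl : c = b + 3 * k := by omega
      have key := add_mem (add_mem (mem (x := (1, 0, 0, 1)) (by simp [hS]) d)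
        (mem (x := (0, 1, 1, 0)) (by simp [hS]) b)) (mem (x := (1, 0, 3, 0)) (by simp [hS]) k)
      simpa [mul_comm] using key
end

section
/- Let k be a field. In the polynomial ring k[x₁, x₂, x₃, x₄], the k-subalgebra spanned by all monomials x₁^a x₂^b x₃^c x₄^d with 3a + b = c + 3d is equal to the k-subalgebra generated by the four elements x₁x₄, x₂x₃, x₁x₃³, x₂³x₄. -/
open MvPolynomial

/-- In `k[x₁, x₂, x₃, x₄]`, the `k`-linear span of the monomials
`x₁^a x₂^b x₃^c x₄^d` with `3a + b = c + 3d` coincides with the `k`-subalgebra generated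
by `x₁x₄`, `x₂x₃`, `x₁x₃³`, `x₂³x₄`. -/
theorem invariant_ring_eq_adjoin (k : Type*) [Field k] :
    Submodule.span k
        {m : MvPolynomial (Fin 4) k | ∃ a b c d : ℕ, 3 * a + b = c + 3 * d ∧
          m = X 0 ^ a * X 1 ^ b * X 2 ^ c * X 3 ^ d} =
      Subalgebra.toSubmodule
        (Algebra.adjoin k
          ({X 0 * X 3, X 1 * X 2, X 0 * X 2 ^ 3, X 1 ^ 3 * X 3} :
            Set (MvPolynomial (Fin 4) k))) := by
  rw [Algebra.adjoin_eq_span]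
  congr 1
  ext m
  refine ⟨?_, fun hm => ?_⟩
  · rintro ⟨a, b, c, d, h, rfl⟩
    rcases le_total d a with hda | hda
    · obtain ⟨e, rfl⟩ := Nat.exists_eq_add_of_le hda
      obtain rfl : c = 3 * e + b := by lia
      have key : (X 0 ^ (d + e) * X 1 ^ b * X 2 ^ (3 * e + b) * X 3 ^ d :
          MvPolynomial (Fin 4) k) =
          (X 0 * X 3) ^ d * (X 1 * X 2) ^ b * (X 0 * X 2 ^ 3) ^ e := by ring
      rw [SetLike.mem_coe, key]
      refine mul_mem (mul_mem ?_ ?_) ?_ <;>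
        exact pow_mem (Submonoid.subset_closure (by simp)) _
    · obtain ⟨e, rfl⟩ := Nat.exists_eq_add_of_le hda
      obtain rfl : b = 3 * e + c := by lia
      have key : (X 0 ^ a * X 1 ^ (3 * e + c) * X 2 ^ c * X 3 ^ (a + e) :
          MvPolynomial (Fin 4) k) =
          (X 0 * X 3) ^ a * (X 1 * X 2) ^ c * (X 1 ^ 3 * X 3) ^ e := by ring
      rw [SetLike.mem_coe, key]
      refine mul_mem (mul_mem ?_ ?_) ?_ <;>
        exact pow_mem (Submonoid.subset_closure (by simp)) _
  · induction hm using Submonoid.closure_induction with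
    | mem x hx =>
      rcases hx with rfl | rfl | rfl | rfl
      · exact ⟨1, 0, 0, 1, by norm_num, by ring⟩
      · exact ⟨0, 1, 1, 0, by norm_num, by ring⟩
      · exact ⟨1, 0, 3, 0, by norm_num, by ring⟩
      · exact ⟨0, 3, 0, 1, by norm_num, by ring⟩
    | one => exact ⟨0, 0, 0, 0, by norm_num, by ring⟩
    | mul x y _ _ hx hy =>
      obtain ⟨a, b, c, d, h, rfl⟩ := hx
      obtain ⟨a', b', c', d', h', rfl⟩ := hy
      exact ⟨a + a', b + b', c + c', d + d', by lia, by ring⟩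
end

section
/- Let k be a field and let α : k[X₁, X₂, X₃, X₄] → k[x₁, x₂, x₃, x₄] be the k-algebra homomorphism determined by α(X₁) = x₁x₄, α(X₂) = x₂x₃, α(X₃) = x₁x₃³, α(X₄) = x₂³x₄. Then the kernel of α is the principal ideal generated by X₃X₄ − X₁X₂³. -/
open MvPolynomial

theorem pow_mul_pow_eq_of_mul_eq {R : Type*} [CommRing R] {u v w z : R} (h : w * z = u * v ^ 3)
    (a b c d : ℕ) :
    u ^ min (a + c) (a + d) * v ^ (b + 3 * d - 3 * (a + d - (a + c))) * w ^ (a + c - (a + d)) *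
      z ^ (a + d - (a + c)) = u ^ a * v ^ b * w ^ c * z ^ d := by
  rcases le_total c d with hcd | hcd
  · obtain ⟨n, rfl⟩ := Nat.exists_eq_add_of_le hcd
    have h₁ : min (a + c) (a + (c + n)) = a + c := by omega
    have h₂ : b + 3 * (c + n) - 3 * (a + (c + n) - (a + c)) = b + 3 * c := by omega
    have h₃ : a + c - (a + (c + n)) = 0 := by omega
    have h₄ : a + (c + n) - (a + c) = n := by omega
    rw [h₁, h₂, h₃, h₄]
    calc _ = u ^ a * v ^ b * (u * v ^ 3) ^ c * z ^ n := by ring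
      _ = _ := by rw [← h]; ring
  · obtain ⟨n, rfl⟩ := Nat.exists_eq_add_of_le hcd
    have h₁ : min (a + (d + n)) (a + d) = a + d := by omega
    have h₂ : b + 3 * d - 3 * (a + d - (a + (d + n))) = b + 3 * d := by omega
    have h₃ : a + (d + n) - (a + d) = n := by omega
    have h₄ : a + d - (a + (d + n)) = 0 := by omega
    rw [h₁, h₂, h₃, h₄]
    calc _ = u ^ a * v ^ b * (u * v ^ 3) ^ d * w ^ n := by ring
      _ = _ := by rw [← h]; ring

/-- The `k`-linear map sending a monomial `x₁ᵃx₂ᵇx₃ᶜx₄ᵈ` of the form `α m` to the class of `m`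
modulo `X₃X₄ − X₁X₂³`, computed from the representative not divisible by `X₃X₄`. -/
noncomputable def alphaSection (k : Type*) [Field k] :
    MvPolynomial (Fin 4) k →ₗ[k]
      MvPolynomial (Fin 4) k ⧸
        Ideal.span {(X 2 * X 3 - X 0 * X 1 ^ 3 : MvPolynomial (Fin 4) k)} :=
  (basisMonomials (Fin 4) k).constr k fun m =>
    Ideal.Quotient.mk _ (X 0 ^ min (m 0) (m 3) * X 1 ^ (m 1 - 3 * (m 3 - m 0)) *
      X 2 ^ (m 0 - m 3) * X 3 ^ (m 3 - m 0))

theorem alphaSection_monomial (k : Type*) [Field k] (m : Fin 4 →₀ ℕ) :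
    alphaSection k (monomial m 1) =
      Ideal.Quotient.mk _ (X 0 ^ min (m 0) (m 3) * X 1 ^ (m 1 - 3 * (m 3 - m 0)) *
        X 2 ^ (m 0 - m 3) * X 3 ^ (m 3 - m 0)) := by
  have h := (basisMonomials (Fin 4) k).constr_basis k (fun m =>
    Ideal.Quotient.mk (Ideal.span {(X 2 * X 3 - X 0 * X 1 ^ 3 : MvPolynomial (Fin 4) k)})
      (X 0 ^ min (m 0) (m 3) * X 1 ^ (m 1 - 3 * (m 3 - m 0)) *
        X 2 ^ (m 0 - m 3) * X 3 ^ (m 3 - m 0))) m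
  rwa [coe_basisMonomials] at h

theorem alphaSection_aeval (k : Type*) [Field k] (p : MvPolynomial (Fin 4) k) :
    alphaSection k
        (aeval (![X 0 * X 3, X 1 * X 2, X 0 * X 2 ^ 3, X 1 ^ 3 * X 3] :
            Fin 4 → MvPolynomial (Fin 4) k) p) = Ideal.Quotient.mk _ p := by
  set I := Ideal.span {(X 2 * X 3 - X 0 * X 1 ^ 3 : MvPolynomial (Fin 4) k)}
  have hrel : Ideal.Quotient.mk I (X 2) * Ideal.Quotient.mk I (X 3) =
      Ideal.Quotient.mk I (X 0) * Ideal.Quotient.mk I (X 1) ^ 3 := by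
    rw [← map_pow, ← map_mul, ← map_mul, Ideal.Quotient.eq]
    exact Ideal.mem_span_singleton_self _
  suffices h : alphaSection k ∘ₗ (aeval (![X 0 * X 3, X 1 * X 2, X 0 * X 2 ^ 3, X 1 ^ 3 * X 3] :
      Fin 4 → MvPolynomial (Fin 4) k)).toLinearMap = (Ideal.Quotient.mkₐ k I).toLinearMap from
    LinearMap.congr_fun h p
  refine (basisMonomials (Fin 4) k).ext fun e => ?_
  have hα : aeval (![X 0 * X 3, X 1 * X 2, X 0 * X 2 ^ 3, X 1 ^ 3 * X 3] :
      Fin 4 → MvPolynomial (Fin 4) k) (monomial e (1 : k)) =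
      monomial (Finsupp.equivFunOnFinite.symm
        ![e 0 + e 2, e 1 + 3 * e 3, e 1 + 3 * e 2, e 0 + e 3]) 1 := by
    rw [aeval_monomial, monomial_eq, Finsupp.prod_fintype _ _ (by simp),
      Finsupp.prod_fintype _ _ (by simp)]
    simp [Fin.prod_univ_four]
    ring
  have he : (monomial e (1 : k)) = X 0 ^ e 0 * X 1 ^ e 1 * X 2 ^ e 2 * X 3 ^ e 3 := by
    rw [monomial_eq, Finsupp.prod_fintype _ _ (by simp)]
    simp [Fin.prod_univ_four]
  simp only [LinearMap.comp_apply, AlgHom.toLinearMap_apply, coe_basisMonomials]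
  rw [hα, alphaSection_monomial, he]
  simpa using pow_mul_pow_eq_of_mul_eq hrel (e 0) (e 1) (e 2) (e 3)

/-- Let `α : k[X₁,X₂,X₃,X₄] → k[x₁,x₂,x₃,x₄]` be the `k`-algebra map with
`α X₁ = x₁x₄`, `α X₂ = x₂x₃`, `α X₃ = x₁x₃³`, `α X₄ = x₂³x₄`. Then
`ker α = (X₃X₄ − X₁X₂³)`. -/
theorem ker_alpha_eq_span (k : Type*) [Field k] :
    RingHom.ker
        (aeval (![X 0 * X 3, X 1 * X 2, X 0 * X 2 ^ 3, X 1 ^ 3 * X 3] :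
            Fin 4 → MvPolynomial (Fin 4) k) :
          MvPolynomial (Fin 4) k →ₐ[k] MvPolynomial (Fin 4) k) =
      Ideal.span {(X 2 * X 3 - X 0 * X 1 ^ 3 : MvPolynomial (Fin 4) k)} := by
  refine le_antisymm (fun p hp => ?_) ?_
  · rw [← Ideal.Quotient.eq_zero_iff_mem, ← alphaSection_aeval, (RingHom.mem_ker).1 hp, map_zero]
  · rw [Ideal.span_singleton_le_iff_mem, RingHom.mem_ker]
    simp
    ring
end
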